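/- arXiv:solv-int/9410001 — 2 statements merged into one kernel-verified Lean document; each statement's English description precedes it below -/
import Mathlib

section
/- Fix N ≥ 1 and n ≥ 1. Let u_1, …, u_n : ℝ² → Matrix(Fin N, Fin N, ℂ) be infinitely differentiable matrix coefficient functions of (x, t), and define L(ψ) = ∂_t ψ + Σ_{i=1}^n u_i · ∂_x^i ψ (no multiplicative term). Let ρ : ℝ² → Matrix(Fin N, Fin N, ℂ) be infinitely differentiable with ∂_x ρ(x,t) invertible for every (x,t), and suppose L(ρ) = 0. Define Gψ = (∂_x ρ)⁻¹ · ∂_x ψ. Then there exist infinitely differentiable matrix functions ũ_1, …, ũ_n : ℝ² → Matrix(Fin N, Fin N, ℂ) such that for every infinitely differentiable ψ : ℝ² → ℂ^N: ∂_t(Gψ) + Σ_{i=1}^n ũ_i · ∂_x^i (Gψ) = G( ∂_t ψ + Σ_{i=1}^n u_i · ∂_x^i ψ ). In particular the transformed operator again has no multiplicative (order-zero) term. -/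
/-- Entrywise partial `x`-derivative of a matrix-valued function on `ℝ × ℝ`
(coordinates `(x, t)`). -/
noncomputable def mpdX {N : ℕ} (f : ℝ × ℝ → Matrix (Fin N) (Fin N) ℂ) :
    ℝ × ℝ → Matrix (Fin N) (Fin N) ℂ :=
  fun p => Matrix.of fun k l => deriv (fun s => f (s, p.2) k l) p.1

/-- Entrywise partial `t`-derivative of a matrix-valued function on `ℝ × ℝ`. -/
noncomputable def mpdT {N : ℕ} (f : ℝ × ℝ → Matrix (Fin N) (Fin N) ℂ) :
    ℝ × ℝ → Matrix (Fin N) (Fin N) ℂ :=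
  fun p => Matrix.of fun k l => deriv (fun s => f (p.1, s) k l) p.2

/-- Partial `x`-derivative of a vector-valued function on `ℝ × ℝ`. -/
noncomputable def vpdX {N : ℕ} (f : ℝ × ℝ → (Fin N → ℂ)) : ℝ × ℝ → (Fin N → ℂ) :=
  fun p => deriv (fun s => f (s, p.2)) p.1

/-- Partial `t`-derivative of a vector-valued function on `ℝ × ℝ`. -/
noncomputable def vpdT {N : ℕ} (f : ℝ × ℝ → (Fin N → ℂ)) : ℝ × ℝ → (Fin N → ℂ) :=
  fun p => deriv (fun s => f (p.1, s)) p.2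


/-- Entrywise smoothness of a matrix-valued function. -/
def MSmooth {N : ℕ} (f : ℝ × ℝ → Matrix (Fin N) (Fin N) ℂ) : Prop :=
  ∀ k l : Fin N, ContDiff ℝ (⊤ : ℕ∞) fun p => f p k l

section Partial

variable {E : Type*} [NormedAddCommGroup E] [NormedSpace ℝ E] {f : ℝ × ℝ → E}

theorem deriv_partial_fst (hf : ContDiff ℝ (⊤ : ℕ∞) f) (p : ℝ × ℝ) :
    deriv (fun s => f (s, p.2)) p.1 = fderiv ℝ f p (1, 0) :=
  (HasFDerivAt.comp_hasDerivAt (f := fun s : ℝ => (s, p.2)) p.1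
    (hf.differentiable (by simp) p).hasFDerivAt
    ((hasDerivAt_id p.1).prodMk (hasDerivAt_const p.1 p.2))).deriv

theorem deriv_partial_snd (hf : ContDiff ℝ (⊤ : ℕ∞) f) (p : ℝ × ℝ) :
    deriv (fun s => f (p.1, s)) p.2 = fderiv ℝ f p (0, 1) :=
  (HasFDerivAt.comp_hasDerivAt (f := fun s : ℝ => (p.1, s)) p.2
    (hf.differentiable (by simp) p).hasFDerivAt
    ((hasDerivAt_const p.2 p.1).prodMk (hasDerivAt_id p.2))).deriv

theorem ContDiff.fderiv_apply_const (hf : ContDiff ℝ (⊤ : ℕ∞) f) (e : ℝ × ℝ) :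
    ContDiff ℝ (⊤ : ℕ∞) fun p => fderiv ℝ f p e :=
  (hf.fderiv_right (by simp)).clm_apply contDiff_const

theorem ContDiff.fderiv_fderiv_comm (hf : ContDiff ℝ (⊤ : ℕ∞) f) (e e' p : ℝ × ℝ) :
    fderiv ℝ (fun q => fderiv ℝ f q e) p e' = fderiv ℝ (fun q => fderiv ℝ f q e') p e := by
  have hd : DifferentiableAt ℝ (fderiv ℝ f) p :=
    (hf.fderiv_right (m := (⊤ : ℕ∞)) (by simp)).differentiable (by simp) p
  have key (v : ℝ × ℝ) :
      fderiv ℝ (fun q => fderiv ℝ f q v) p = (fderiv ℝ (fderiv ℝ f) p).flip v := by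
    rw [fderiv_clm_apply hd (differentiableAt_const v)]
    ext <;> simp
  have hs : IsSymmSndFDerivAt ℝ f p := hf.contDiffAt.isSymmSndFDerivAt
    (by rw [minSmoothness_of_isRCLikeNormedField]; exact WithTop.coe_le_coe.2 (le_top : (2 : ℕ∞) ≤ ⊤))
  rw [key, key]
  exact hs e' e

end Partial

section Derivations

variable {N : ℕ} {A B : ℝ × ℝ → Matrix (Fin N) (Fin N) ℂ} {v : ℝ × ℝ → (Fin N → ℂ)}

theorem vpdX_eq (hv : ContDiff ℝ (⊤ : ℕ∞) v) : vpdX v = fun p => fderiv ℝ v p (1, 0) :=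
  funext (deriv_partial_fst hv)

theorem vpdT_eq (hv : ContDiff ℝ (⊤ : ℕ∞) v) : vpdT v = fun p => fderiv ℝ v p (0, 1) :=
  funext (deriv_partial_snd hv)

theorem mpdX_eq (hA : MSmooth A) :
    mpdX A = fun p => Matrix.of fun k l => fderiv ℝ (fun q => A q k l) p (1, 0) := by
  ext p k l
  exact deriv_partial_fst (hA k l) p

theorem mpdT_eq (hA : MSmooth A) :
    mpdT A = fun p => Matrix.of fun k l => fderiv ℝ (fun q => A q k l) p (0, 1) := by
  ext p k l
  exact deriv_partial_snd (hA k l) p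

theorem contDiff_vpdX (hv : ContDiff ℝ (⊤ : ℕ∞) v) : ContDiff ℝ (⊤ : ℕ∞) (vpdX v) :=
  vpdX_eq hv ▸ hv.fderiv_apply_const _

theorem contDiff_vpdT (hv : ContDiff ℝ (⊤ : ℕ∞) v) : ContDiff ℝ (⊤ : ℕ∞) (vpdT v) :=
  vpdT_eq hv ▸ hv.fderiv_apply_const _

theorem contDiff_iterate_vpdX (hv : ContDiff ℝ (⊤ : ℕ∞) v) (m : ℕ) :
    ContDiff ℝ (⊤ : ℕ∞) (vpdX^[m] v) := by
  induction m with
  | zero => exact hv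
  | succ m ih => rw [Function.iterate_succ_apply']; exact contDiff_vpdX ih

theorem MSmooth.mpdX (hA : MSmooth A) : MSmooth (mpdX A) :=
  mpdX_eq hA ▸ fun k l => (hA k l).fderiv_apply_const _

theorem MSmooth.mpdT (hA : MSmooth A) : MSmooth (mpdT A) :=
  mpdT_eq hA ▸ fun k l => (hA k l).fderiv_apply_const _

theorem MSmooth.zero : MSmooth (0 : ℝ × ℝ → Matrix (Fin N) (Fin N) ℂ) :=
  fun _ _ => contDiff_const

theorem MSmooth.add (hA : MSmooth A) (hB : MSmooth B) : MSmooth (A + B) :=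
  fun k l => (hA k l).add (hB k l)

theorem MSmooth.mul (hA : MSmooth A) (hB : MSmooth B) : MSmooth (fun p => A p * B p) :=
  fun k l => by
    simp only [Matrix.mul_apply]
    exact ContDiff.sum fun j _ => (hA k j).mul (hB j l)

theorem MSmooth.sum {ι : Type*} {s : Finset ι} {F : ι → ℝ × ℝ → Matrix (Fin N) (Fin N) ℂ}
    (hF : ∀ i ∈ s, MSmooth (F i)) : MSmooth (fun p => ∑ i ∈ s, F i p) := fun k l => by
  simp only [Matrix.sum_apply]
  exact ContDiff.sum fun i hi => hF i hi k l

theorem MSmooth.det (hA : MSmooth A) : ContDiff ℝ (⊤ : ℕ∞) fun p => (A p).det := by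
  simp only [Matrix.det_apply']
  exact ContDiff.sum fun σ _ => contDiff_const.mul (contDiff_prod fun i _ => hA _ _)

theorem MSmooth.inv (hA : MSmooth A) (hu : ∀ p, IsUnit (A p)) : MSmooth (fun p => (A p)⁻¹) :=
  fun k l => by
    simp only [Matrix.inv_def, Ring.inverse_eq_inv', Matrix.smul_apply, smul_eq_mul,
      Matrix.adjugate_apply]
    refine (hA.det.inv fun p => ((Matrix.isUnit_iff_isUnit_det _).1 (hu p)).ne_zero).mul
      (MSmooth.det (A := fun p => (A p).updateRow l (Pi.single k 1)) fun i j => ?_)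
    simp only [Matrix.updateRow_apply]
    split_ifs
    · exact contDiff_const
    · exact hA i j

theorem MSmooth.mulVec (hA : MSmooth A) (hv : ContDiff ℝ (⊤ : ℕ∞) v) :
    ContDiff ℝ (⊤ : ℕ∞) fun p => (A p).mulVec (v p) := by
  rw [contDiff_pi]
  intro k
  simp only [Matrix.mulVec, dotProduct]
  exact ContDiff.sum fun j _ => (hA k j).mul ((contDiff_pi.1 hv) j)

theorem MSmooth.fderiv_mulVec (hA : MSmooth A) (hv : ContDiff ℝ (⊤ : ℕ∞) v) (p e : ℝ × ℝ) :
    fderiv ℝ (fun q => (A q).mulVec (v q)) p e =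
      (Matrix.of fun k l => fderiv ℝ (fun q => A q k l) p e).mulVec (v p) +
        (A p).mulVec (fderiv ℝ v p e) := by
  have hv' (j : Fin N) : HasFDerivAt (fun q => v q j)
      ((ContinuousLinearMap.proj j).comp (fderiv ℝ v p)) p :=
    hasFDerivAt_pi'.1 (hv.differentiable (by simp) p).hasFDerivAt j
  have hA' (k j : Fin N) := ((hA k j).differentiable (by simp) p).hasFDerivAt
  ext k
  have h := hasFDerivAt_pi'.1 ((hA.mulVec hv).differentiable (by simp) p).hasFDerivAt k
  have h' : HasFDerivAt (fun q => (A q).mulVec (v q) k) _ p :=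
    HasFDerivAt.fun_sum fun j (_ : j ∈ Finset.univ) => (hA' k j).mul (hv' j)
  have := DFunLike.congr_fun (h.unique h') e
  simp only [ContinuousLinearMap.comp_apply, ContinuousLinearMap.proj_apply] at this
  rw [this]
  simp [Matrix.mulVec, dotProduct, Finset.sum_add_distrib, mul_comm, add_comm]

theorem MSmooth.vpdX_mulVec (hA : MSmooth A) (hv : ContDiff ℝ (⊤ : ℕ∞) v) :
    vpdX (fun q => (A q).mulVec (v q)) =
      fun p => (_root_.mpdX A p).mulVec (v p) + (A p).mulVec (vpdX v p) := by
  rw [vpdX_eq (hA.mulVec hv), vpdX_eq hv, mpdX_eq hA]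
  exact funext fun p => hA.fderiv_mulVec hv p _

theorem MSmooth.vpdT_mulVec (hA : MSmooth A) (hv : ContDiff ℝ (⊤ : ℕ∞) v) :
    vpdT (fun q => (A q).mulVec (v q)) =
      fun p => (_root_.mpdT A p).mulVec (v p) + (A p).mulVec (vpdT v p) := by
  rw [vpdT_eq (hA.mulVec hv), vpdT_eq hv, mpdT_eq hA]
  exact funext fun p => hA.fderiv_mulVec hv p _

theorem vpdX_vpdT_comm (hv : ContDiff ℝ (⊤ : ℕ∞) v) : vpdX (vpdT v) = vpdT (vpdX v) := by
  rw [vpdX_eq (contDiff_vpdT hv), vpdT_eq (contDiff_vpdX hv), vpdT_eq hv, vpdX_eq hv]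
  exact funext fun p => hv.fderiv_fderiv_comm _ _ p

theorem mpdX_mpdT_comm (hA : MSmooth A) : mpdX (mpdT A) = mpdT (mpdX A) := by
  rw [mpdX_eq hA.mpdT, mpdT_eq hA.mpdX, mpdT_eq hA, mpdX_eq hA]
  ext p k l
  exact (hA k l).fderiv_fderiv_comm _ _ p

theorem mpdX_neg : mpdX (-A) = -mpdX A := by
  ext p k l
  exact deriv.fun_neg

theorem mpdX_zero : mpdX (0 : ℝ × ℝ → Matrix (Fin N) (Fin N) ℂ) = 0 := by
  ext p k l
  exact deriv_const _ _

theorem vpdX_add {w : ℝ × ℝ → (Fin N → ℂ)} (hv : ContDiff ℝ (⊤ : ℕ∞) v)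
    (hw : ContDiff ℝ (⊤ : ℕ∞) w) : vpdX (fun p => v p + w p) = fun p => vpdX v p + vpdX w p := by
  rw [vpdX_eq (hv.add hw), vpdX_eq hv, vpdX_eq hw]
  funext p
  rw [fderiv_fun_add (hv.differentiable (by simp) p) (hw.differentiable (by simp) p)]
  rfl

theorem vpdX_sum {ι : Type*} {s : Finset ι} {F : ι → ℝ × ℝ → (Fin N → ℂ)}
    (hF : ∀ i ∈ s, ContDiff ℝ (⊤ : ℕ∞) (F i)) :
    vpdX (fun p => ∑ i ∈ s, F i p) = fun p => ∑ i ∈ s, vpdX (F i) p := by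
  rw [vpdX_eq (ContDiff.sum hF)]
  funext p
  rw [fderiv_fun_sum fun i hi => (hF i hi).differentiable (by simp) p,
    _root_.sum_apply]
  exact Finset.sum_congr rfl fun i hi => (congrFun (vpdX_eq (hF i hi)) p).symm

end Derivations

section Coefficients

variable {N : ℕ}

/-- Coefficients of the composition of `∂_x` with the operator `∑ A_j ∂_x^j`. -/
noncomputable def coeffX (A : ℕ → ℝ × ℝ → Matrix (Fin N) (Fin N) ℂ) :
    ℕ → ℝ × ℝ → Matrix (Fin N) (Fin N) ℂ
  | 0 => mpdX (A 0)
  | j + 1 => mpdX (A (j + 1)) + A j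

variable {A : ℕ → ℝ × ℝ → Matrix (Fin N) (Fin N) ℂ}

theorem MSmooth.coeffX (hA : ∀ j, MSmooth (A j)) : ∀ j, MSmooth (coeffX A j)
  | 0 => (hA 0).mpdX
  | j + 1 => (hA (j + 1)).mpdX.add (hA j)

theorem coeffX_eq_zero {m : ℕ} (h : ∀ j, m ≤ j → A j = 0) :
    ∀ j, m + 1 ≤ j → coeffX A j = 0
  | 0, hj => absurd hj (by omega)
  | j + 1, hj => by
    rw [coeffX, h (j + 1) (by omega), h j (by omega), mpdX_zero, add_zero]

theorem vpdX_sum_mulVec {m : ℕ} (hA : ∀ j, MSmooth (A j)) (h : ∀ j, m ≤ j → A j = 0)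
    {φ : ℝ × ℝ → (Fin N → ℂ)} (hφ : ContDiff ℝ (⊤ : ℕ∞) φ) :
    vpdX (fun q => ∑ j ∈ Finset.range m, (A j q).mulVec ((vpdX^[j] φ) q)) =
      fun q => ∑ j ∈ Finset.range (m + 1), (coeffX A j q).mulVec ((vpdX^[j] φ) q) := by
  rw [vpdX_sum fun j _ => (hA j).mulVec (contDiff_iterate_vpdX hφ j)]
  funext p
  have hz : (mpdX (A m) p).mulVec ((vpdX^[m] φ) p) = 0 := by simp [h m le_rfl, mpdX_zero]
  have hs := Finset.sum_range_succ (fun j => (mpdX (A j) p).mulVec ((vpdX^[j] φ) p)) m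
  rw [hz, add_zero, Finset.sum_range_succ'] at hs
  rw [Finset.sum_range_succ']
  simp only [coeffX, Pi.add_apply, Matrix.add_mulVec, Finset.sum_add_distrib,
    (hA _).vpdX_mulVec (contDiff_iterate_vpdX hφ _), Function.iterate_succ_apply'] at hs ⊢
  rw [← hs]
  abel

/-- Coefficients of the operator `φ ↦ ∂_x^m (R φ)`. -/
noncomputable def leibnizCoeff (R : ℝ × ℝ → Matrix (Fin N) (Fin N) ℂ) (m : ℕ) :
    ℕ → ℝ × ℝ → Matrix (Fin N) (Fin N) ℂ :=
  coeffX^[m] (Pi.single 0 R)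

variable {R : ℝ × ℝ → Matrix (Fin N) (Fin N) ℂ}

theorem leibnizCoeff_succ (m : ℕ) : leibnizCoeff R (m + 1) = coeffX (leibnizCoeff R m) :=
  Function.iterate_succ_apply' _ _ _

theorem leibnizCoeff_apply_zero (m : ℕ) : leibnizCoeff R m 0 = mpdX^[m] R := by
  induction m with
  | zero => simp [leibnizCoeff]
  | succ m ih => rw [leibnizCoeff_succ, Function.iterate_succ_apply', coeffX, ih]

theorem MSmooth.leibnizCoeff (hR : MSmooth R) (m : ℕ) :
    ∀ j, MSmooth (leibnizCoeff R m j) := by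
  induction m with
  | zero =>
    intro j
    cases j with
    | zero => simpa [_root_.leibnizCoeff] using hR
    | succ j => simpa [_root_.leibnizCoeff] using MSmooth.zero
  | succ m ih => rw [leibnizCoeff_succ]; exact MSmooth.coeffX ih

theorem leibnizCoeff_eq_zero (m : ℕ) : ∀ j, m + 1 ≤ j → leibnizCoeff R m j = 0 := by
  induction m with
  | zero =>
    intro j hj
    have hj' : j ≠ 0 := by omega
    simp [leibnizCoeff, hj']
  | succ m ih => rw [leibnizCoeff_succ]; exact coeffX_eq_zero ih

theorem iterate_vpdX_mulVec (hR : MSmooth R) {φ : ℝ × ℝ → (Fin N → ℂ)}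
    (hφ : ContDiff ℝ (⊤ : ℕ∞) φ) (m : ℕ) :
    vpdX^[m] (fun q => (R q).mulVec (φ q)) =
      fun q => ∑ j ∈ Finset.range (m + 1), (leibnizCoeff R m j q).mulVec ((vpdX^[j] φ) q) := by
  induction m with
  | zero => simp [leibnizCoeff]
  | succ m ih =>
    rw [Function.iterate_succ_apply', ih, leibnizCoeff_succ,
      vpdX_sum_mulVec (hR.leibnizCoeff m) (leibnizCoeff_eq_zero m) hφ]

/-- Coefficients of the operator `φ ↦ ∑ u_i ∂_x^(i-1) (R φ)`. -/
noncomputable def dressedCoeff (n : ℕ) (u : ℕ → ℝ × ℝ → Matrix (Fin N) (Fin N) ℂ)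
    (R : ℝ × ℝ → Matrix (Fin N) (Fin N) ℂ) (j : ℕ) : ℝ × ℝ → Matrix (Fin N) (Fin N) ℂ :=
  fun p => ∑ i ∈ Finset.Icc 1 n, u i p * leibnizCoeff R (i - 1) j p

variable {n : ℕ} {u : ℕ → ℝ × ℝ → Matrix (Fin N) (Fin N) ℂ}

theorem MSmooth.dressedCoeff (hu : ∀ i ∈ Finset.Icc 1 n, MSmooth (u i)) (hR : MSmooth R)
    (j : ℕ) : MSmooth (dressedCoeff n u R j) :=
  MSmooth.sum fun i hi => (hu i hi).mul (hR.leibnizCoeff (i - 1) j)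

theorem dressedCoeff_eq_zero (j : ℕ) (hj : n ≤ j) : dressedCoeff n u R j = 0 := by
  funext p
  refine Finset.sum_eq_zero fun i hi => ?_
  rw [Finset.mem_Icc] at hi
  rw [leibnizCoeff_eq_zero (i - 1) j (by omega), Pi.zero_apply, mul_zero]

theorem sum_mulVec_iterate_vpdX (hR : MSmooth R) {ψ φ : ℝ × ℝ → (Fin N → ℂ)}
    (hφ : ContDiff ℝ (⊤ : ℕ∞) φ) (hψ : vpdX ψ = fun q => (R q).mulVec (φ q)) (q : ℝ × ℝ) :
    ∑ i ∈ Finset.Icc 1 n, (u i q).mulVec ((vpdX^[i] ψ) q) =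
      ∑ j ∈ Finset.range n, (dressedCoeff n u R j q).mulVec ((vpdX^[j] φ) q) := by
  simp only [dressedCoeff, Matrix.sum_mulVec]
  rw [Finset.sum_comm]
  refine Finset.sum_congr rfl fun i hi => ?_
  rw [Finset.mem_Icc] at hi
  obtain ⟨i, rfl⟩ := Nat.exists_eq_add_of_le' hi.1
  rw [Function.iterate_succ_apply, hψ, iterate_vpdX_mulVec hR hφ, Matrix.mulVec_sum]
  simp only [Matrix.mulVec_mulVec, Nat.add_sub_cancel]
  refine Finset.sum_subset (Finset.range_subset_range.2 hi.2) fun j _ hj => ?_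
  rw [leibnizCoeff_eq_zero i j (by simpa using hj)]
  simp

end Coefficients

/-- Second elementary Darboux transformation `G = ρ_x⁻¹ ∂_x` for matrix
operators `L = ∂_t + Σ_{i=1}^n u_i ∂_x^i` without multiplicative term.  Given
a matrix solution `ρ` of `L(ρ) = 0` with `ρ_x` everywhere invertible, there
is an operator `L̃` of the same form (again with no order-zero term) with
`L̃(Gψ) = G(L(ψ))` for every smooth `ψ`. -/
theorem elementary_darboux_two (N n : ℕ) (hN : 1 ≤ N) (hn : 1 ≤ n)
    (u : ℕ → ℝ × ℝ → Matrix (Fin N) (Fin N) ℂ)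
    (hu : ∀ i ∈ Finset.Icc 1 n, ∀ k l : Fin N, ContDiff ℝ (⊤ : ℕ∞) fun p => u i p k l)
    (ρ : ℝ × ℝ → Matrix (Fin N) (Fin N) ℂ)
    (hρs : ∀ k l : Fin N, ContDiff ℝ (⊤ : ℕ∞) fun p => ρ p k l)
    (hρinv : ∀ p : ℝ × ℝ, IsUnit (mpdX ρ p))
    (hρL : ∀ p : ℝ × ℝ,
      mpdT ρ p + ∑ i ∈ Finset.Icc 1 n, u i p * (mpdX^[i] ρ) p = 0) :
    ∃ ut : ℕ → ℝ × ℝ → Matrix (Fin N) (Fin N) ℂ,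
      (∀ i ∈ Finset.Icc 1 n, ∀ k l : Fin N, ContDiff ℝ (⊤ : ℕ∞) fun p => ut i p k l) ∧
      ∀ ψ : ℝ × ℝ → (Fin N → ℂ), ContDiff ℝ (⊤ : ℕ∞) ψ →
        ∀ p : ℝ × ℝ,
          vpdT (fun q => ((mpdX ρ q)⁻¹).mulVec (vpdX ψ q)) p +
              ∑ i ∈ Finset.Icc 1 n,
                (ut i p).mulVec
                  ((vpdX^[i] fun q => ((mpdX ρ q)⁻¹).mulVec (vpdX ψ q)) p) =
            ((mpdX ρ p)⁻¹).mulVec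
              (vpdX (fun q => vpdT ψ q +
                  ∑ i ∈ Finset.Icc 1 n, (u i q).mulVec ((vpdX^[i] ψ) q)) p) := by
  have hρ : MSmooth ρ := hρs
  have hR : MSmooth (mpdX ρ) := hρ.mpdX
  have hRi : MSmooth (fun p => (mpdX ρ p)⁻¹) := hR.inv hρinv
  have hB : ∀ j, MSmooth (dressedCoeff n u (mpdX ρ) j) := MSmooth.dressedCoeff hu hR
  have hB0 : dressedCoeff n u (mpdX ρ) 0 = -mpdT ρ := by
    funext p
    rw [Pi.neg_apply, ← eq_neg_of_add_eq_zero_right (hρL p)]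
    refine Finset.sum_congr rfl fun i hi => ?_
    rw [Finset.mem_Icc] at hi
    rw [leibnizCoeff_apply_zero, ← Function.iterate_succ_apply, Nat.succ_eq_add_one,
      Nat.sub_add_cancel hi.1]
  refine ⟨fun i p => (mpdX ρ p)⁻¹ * coeffX (dressedCoeff n u (mpdX ρ)) i p,
    fun i _ => hRi.mul (MSmooth.coeffX hB i), fun ψ hψ p => ?_⟩
  have hdet (q : ℝ × ℝ) : IsUnit (mpdX ρ q).det := (Matrix.isUnit_iff_isUnit_det _).1 (hρinv q)
  have hφ : ContDiff ℝ (⊤ : ℕ∞) fun q => ((mpdX ρ q)⁻¹).mulVec (vpdX ψ q) :=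
    hRi.mulVec (contDiff_vpdX hψ)
  obtain ⟨φ, hφe⟩ : ∃ φ, φ = fun q => ((mpdX ρ q)⁻¹).mulVec (vpdX ψ q) := ⟨_, rfl⟩
  have hψφ : vpdX ψ = fun q => (mpdX ρ q).mulVec (φ q) := by
    funext q
    rw [hφe, Matrix.mulVec_mulVec, Matrix.mul_nonsing_inv _ (hdet q), Matrix.one_mulVec]
  rw [← hφe] at hφ ⊢
  simp only [sum_mulVec_iterate_vpdX hR hφ hψφ]
  rw [vpdX_add (contDiff_vpdT hψ)
      (ContDiff.sum fun j _ => (hB j).mulVec (contDiff_iterate_vpdX hφ j)),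
    vpdX_sum_mulVec hB dressedCoeff_eq_zero hφ, vpdX_vpdT_comm hψ, hψφ, hR.vpdT_mulVec hφ]
  simp only [← Matrix.mulVec_mulVec, ← Matrix.mulVec_sum]
  have hC0 : coeffX (dressedCoeff n u (mpdX ρ)) 0 = -mpdT (mpdX ρ) := by
    rw [coeffX, hB0, mpdX_neg, mpdX_mpdT_comm hρ]
  have hshift (F : ℕ → Fin N → ℂ) :
      ∑ j ∈ Finset.range n, F (j + 1) = ∑ i ∈ Finset.Icc 1 n, F i := by
    rw [Finset.range_eq_Ico, Finset.sum_Ico_add' F 0 n 1]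
    rfl
  rw [Finset.sum_range_succ', hC0,
    hshift fun i => (coeffX (dressedCoeff n u (mpdX ρ)) i p).mulVec ((vpdX^[i] φ) p)]
  simp only [Matrix.mulVec_add, Pi.neg_apply, Matrix.neg_mulVec, Matrix.mulVec_neg,
    Matrix.mulVec_mulVec, Matrix.nonsing_inv_mul _ (hdet p), Matrix.one_mulVec,
    Function.iterate_zero, id_eq]
  abel
end

section
/- Fix N ≥ 1 and n ≥ 1. Let u_1, …, u_n : ℝ² → Matrix(Fin N, Fin N, ℂ) be infinitely differentiable matrix coefficient functions of (x, t), and define L(ψ) = ∂_t ψ + Σ_{i=1}^n u_i · ∂_x^i ψ (no multiplicative term). Let θ : ℝ² → Matrix(Fin N, Fin N, ℂ) be infinitely differentiable such that both θ(x,t) and ∂_x(θ⁻¹)(x,t) are invertible for every (x,t), and suppose L(θ) = 0. Define the composed Darboux operator G_θ ψ = (∂_x(θ⁻¹))⁻¹ · ∂_x( θ⁻¹ ψ ). Then there exist infinitely differentiable matrix functions ũ_1, …, ũ_n : ℝ² → Matrix(Fin N, Fin N, ℂ) such that for every infinitely differentiable ψ : ℝ² → ℂ^N: ∂_t(G_θψ)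 + Σ_{i=1}^n ũ_i · ∂_x^i (G_θψ) = G_θ( ∂_t ψ + Σ_{i=1}^n u_i · ∂_x^i ψ ). -/
section DifferentialRing

variable {R : Type*} [Ring R]

/-- The general Leibniz rule for an additive derivation of a noncommutative ring. -/
lemma iterate_leibniz (d : R →+ R) (hd : ∀ a b, d (a * b) = d a * b + a * d b)
    (a b : R) (n : ℕ) :
    d^[n] (a * b) =
      ∑ ij ∈ Finset.HasAntidiagonal.antidiagonal n, n.choose ij.1 • (d^[ij.1] a * d^[ij.2] b) := by
  induction n with
  | zero => simp
  | succ n ih =>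
    rw [Finset.sum_antidiagonal_choose_succ_nsmul (fun i j => d^[i] a * d^[j] b) n,
      Function.iterate_succ_apply', ih, map_sum, ← Finset.sum_add_distrib]
    refine Finset.sum_congr rfl fun ij hij => ?_
    rw [map_nsmul, hd, nsmul_add, Function.iterate_succ_apply', Function.iterate_succ_apply',
      add_comm, Nat.choose_symm_of_eq_add (Finset.HasAntidiagonal.mem_antidiagonal.mp hij).symm]

/-- Conjugating `τ + ∑ c i ∂ ^ i` by an invertible element annihilated by it produces an operator
of the same order without multiplicative term. -/
lemma exists_gauge (d τ : R →+ R) (hd : ∀ a b, d (a * b) = d a * b + a * d b)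
    (hτ : ∀ a b, τ (a * b) = τ a * b + a * τ b) (n : ℕ) (c : ℕ → R) {a b : R}
    (hab : a * b = 1) (hba : b * a = 1)
    (ha : τ a + ∑ i ∈ Finset.range (n + 1), c i * d^[i] a = 0) :
    ∃ c' : ℕ → R, c' 0 = 0 ∧ ∀ v,
      τ (a * v) + ∑ i ∈ Finset.range (n + 1), c i * d^[i] (a * v) =
        a * (τ v + ∑ i ∈ Finset.range (n + 1), c' i * d^[i] v) := by
  have key : ∃ c' : ℕ → R, ∀ v,
      τ (a * v) + ∑ i ∈ Finset.range (n + 1), c i * d^[i] (a * v) =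
        a * (τ v + ∑ i ∈ Finset.range (n + 1), c' i * d^[i] v) := by
    refine ⟨fun j => b * ((if j = 0 then τ a else 0) +
      ∑ i ∈ Finset.range (n + 1), c i * (i.choose (i - j) • d^[i - j] a) *
        if j ≤ i then 1 else 0), fun v => ?_⟩
    have h1 : ∀ i ∈ Finset.range (n + 1), c i * d^[i] (a * v) =
        ∑ j ∈ Finset.range (n + 1), c i * (i.choose (i - j) • d^[i - j] a) *
          (if j ≤ i then 1 else 0) * d^[j] v := by
      intro i hi
      have hi' := Finset.mem_range.mp hi
      rw [iterate_leibniz d hd, Finset.Nat.sum_antidiagonal_eq_sum_range_succ_mk,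
        ← Finset.sum_range_reflect, Finset.mul_sum]
      have hsub : Finset.range (i + 1) ⊆ Finset.range (n + 1) :=
        Finset.range_subset_range.mpr (by omega)
      rw [← Finset.sum_subset hsub]
      · refine Finset.sum_congr rfl fun j hj => ?_
        have hj' := Finset.mem_range.mp hj
        have e1 : i + 1 - 1 - j = i - j := by omega
        have e2 : i - (i - j) = j := by omega
        simp only [e1, e2]
        rw [if_pos (by omega), mul_one, mul_assoc, smul_mul_assoc]
      · intro j _ hj
        rw [if_neg (by simpa using hj)]
        simp
    rw [Finset.sum_congr rfl h1, Finset.sum_comm, mul_add, hτ, Finset.mul_sum]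
    simp only [mul_assoc, ← mul_assoc a b, hab, one_mul, add_mul, Finset.sum_add_distrib,
      Finset.sum_mul, ite_mul, zero_mul]
    rw [Finset.sum_ite_eq' (Finset.range (n + 1)) 0]
    simp only [Finset.mem_range, Nat.succ_pos, if_true, Function.iterate_zero, id]
    abel
  obtain ⟨c', hc'⟩ := key
  refine ⟨c', ?_, hc'⟩
  have hd1 : d 1 = 0 := by simpa using hd 1 1
  have hτ1 : τ 1 = 0 := by simpa using hτ 1 1
  have hdi : ∀ i, d^[i + 1] 1 = 0 := fun i => by
    rw [Function.iterate_succ_apply, hd1, iterate_map_zero]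
  have h := hc' 1
  rw [mul_one, ha, Finset.sum_range_succ'] at h
  simp only [hdi, mul_zero, Finset.sum_const_zero, hτ1, zero_add, Function.iterate_zero, id,
    mul_one] at h
  rw [← one_mul (c' 0), ← hba, mul_assoc, ← h, mul_zero]

/-- The composed Darboux transformation in a ring with two commuting derivations. -/
lemma exists_darboux (d τ : R →+ R) (hd : ∀ a b, d (a * b) = d a * b + a * d b)
    (hτ : ∀ a b, τ (a * b) = τ a * b + a * τ b) (hdτ : ∀ a, d (τ a) = τ (d a))
    (n : ℕ) (u : ℕ → R) {θ ρ B : R} (hθρ : θ * ρ = 1) (hρθ : ρ * θ = 1)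
    (hρB : d ρ * B = 1) (hBρ : B * d ρ = 1)
    (hθ : τ θ + ∑ i ∈ Finset.Icc 1 n, u i * d^[i] θ = 0) :
    ∃ ut : ℕ → R, ∀ ψ,
      τ (B * d (ρ * ψ)) + ∑ i ∈ Finset.Icc 1 n, ut i * d^[i] (B * d (ρ * ψ)) =
        B * d (ρ * (τ ψ + ∑ i ∈ Finset.Icc 1 n, u i * d^[i] ψ)) := by
  have hsum : ∀ c : ℕ → R, c 0 = 0 → ∀ X : ℕ → R,
      ∑ i ∈ Finset.range (n + 1), c i * X i = ∑ i ∈ Finset.Icc 1 n, c i * X i := by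
    intro c hc X
    rw [Finset.sum_range_succ', hc, zero_mul, add_zero, Finset.range_eq_Ico,
      Finset.sum_Ico_add' (fun i => c i * X i) 0 n 1]
    rfl
  set c : ℕ → R := fun i => if i = 0 then 0 else u i with hc
  have hcu : ∀ X : ℕ → R, ∑ i ∈ Finset.Icc 1 n, u i * X i =
      ∑ i ∈ Finset.range (n + 1), c i * X i := by
    intro X
    rw [hsum c (by simp [hc])]
    refine Finset.sum_congr rfl fun i hi => ?_
    have : i ≠ 0 := by have := (Finset.mem_Icc.mp hi).1; omega
    simp [hc, this]
  simp only [hcu] at hθ ⊢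
  obtain ⟨v, hv0, hv⟩ := exists_gauge d τ hd hτ n c hθρ hρθ hθ
  have hv' : ∀ φ, τ φ + ∑ i ∈ Finset.range (n + 1), v i * d^[i] φ =
      ρ * (τ (θ * φ) + ∑ i ∈ Finset.range (n + 1), c i * d^[i] (θ * φ)) := by
    intro φ
    rw [hv, ← mul_assoc, hρθ, one_mul]
  set w : ℕ → R := fun j => (if j < n then d (v (j + 1)) else 0) + v j with hw
  have hdM : ∀ φ, d (τ φ + ∑ i ∈ Finset.range (n + 1), v i * d^[i] φ) =
      τ (d φ) + ∑ i ∈ Finset.range (n + 1), w i * d^[i] (d φ) := by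
    intro φ
    have h2 : ∑ i ∈ Finset.range (n + 1), v i * d^[i] (d φ) =
        ∑ i ∈ Finset.range n, v (i + 1) * d^[i + 1] (d φ) := by
      rw [Finset.sum_range_succ', hv0, zero_mul, add_zero]
    have h3 : ∑ i ∈ Finset.range (n + 1), (if i < n then d (v (i + 1)) else 0) * d^[i] (d φ) =
        ∑ i ∈ Finset.range n, d (v (i + 1)) * d^[i] (d φ) := by
      rw [Finset.sum_range_succ, if_neg (lt_irrefl n), zero_mul, add_zero]
      exact Finset.sum_congr rfl fun i hi => by rw [if_pos (Finset.mem_range.mp hi)]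
    simp only [hw, add_mul, Finset.sum_add_distrib]
    rw [h2, h3, Finset.sum_range_succ', hv0, zero_mul, add_zero, map_add, map_sum, hdτ,
      ← Finset.sum_add_distrib]
    refine congrArg _ (Finset.sum_congr rfl fun i _ => ?_)
    rw [hd, ← Function.iterate_succ_apply' d, Function.iterate_succ_apply d i φ,
      Function.iterate_succ_apply d (i + 1) φ]
  have hd1 : d 1 = 0 := by simpa using hd 1 1
  have hτ1 : τ 1 = 0 := by simpa using hτ 1 1
  have hMρ : τ (d ρ) + ∑ i ∈ Finset.range (n + 1), w i * d^[i] (d ρ) = 0 := by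
    rw [← hdM, hv', hθρ, hτ1, Finset.sum_range_succ']
    simp [Function.iterate_succ_apply, hd1, iterate_map_zero, hc]
  obtain ⟨ut, hut0, hut⟩ := exists_gauge d τ hd hτ n w hρB hBρ hMρ
  refine ⟨ut, fun ψ => ?_⟩
  have h := hut (B * d (ρ * ψ))
  rw [← mul_assoc, hρB, one_mul, ← hdM, hv', ← mul_assoc, hθρ, one_mul] at h
  rw [h, ← mul_assoc, hBρ, one_mul, hsum ut hut0]

end DifferentialRing

section SmoothMatrix

variable {N : ℕ}

lemma ContDiff.hasDerivAt_slice_fst {g : ℝ × ℝ → ℂ} (hg : ContDiff ℝ (⊤ : ℕ∞) g) (p : ℝ × ℝ) :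
    HasDerivAt (fun s => g (s, p.2)) (fderiv ℝ g p (1, 0)) p.1 := by
  have h := (hg.differentiable (by simp) p).hasFDerivAt
  exact HasFDerivAt.comp_hasDerivAt (f := fun s : ℝ => (s, p.2)) p.1 h
    ((hasDerivAt_id p.1).prodMk (hasDerivAt_const p.1 p.2))

lemma ContDiff.hasDerivAt_slice_snd {g : ℝ × ℝ → ℂ} (hg : ContDiff ℝ (⊤ : ℕ∞) g) (p : ℝ × ℝ) :
    HasDerivAt (fun s => g (p.1, s)) (fderiv ℝ g p (0, 1)) p.2 := by
  have h := (hg.differentiable (by simp) p).hasFDerivAt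
  exact HasFDerivAt.comp_hasDerivAt (f := fun s : ℝ => (p.1, s)) p.2 h
    ((hasDerivAt_const p.2 p.1).prodMk (hasDerivAt_id p.2))

lemma contDiff_fderiv_apply_const {g : ℝ × ℝ → ℂ} (hg : ContDiff ℝ (⊤ : ℕ∞) g) (v : ℝ × ℝ) :
    ContDiff ℝ (⊤ : ℕ∞) fun p => fderiv ℝ g p v :=
  (hg.fderiv_right (m := (⊤ : ℕ∞)) (by simp)).clm_apply contDiff_const

lemma fderiv_fderiv_apply_comm {g : ℝ × ℝ → ℂ} (hg : ContDiff ℝ (⊤ : ℕ∞) g) (p v w : ℝ × ℝ) :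
    fderiv ℝ (fun q => fderiv ℝ g q v) p w = fderiv ℝ (fun q => fderiv ℝ g q w) p v := by
  have h1 : DifferentiableAt ℝ (fderiv ℝ g) p :=
    (hg.fderiv_right (m := (⊤ : ℕ∞)) (by simp)).differentiable (by simp) p
  have hs : IsSymmSndFDerivAt ℝ g p :=
    (contDiff_infty.mp hg 2).contDiffAt.isSymmSndFDerivAt (by simp)
  rw [fderiv_clm_apply h1 (by fun_prop), fderiv_clm_apply h1 (by fun_prop)]
  simpa using hs w v

/-- The ring of matrix functions on the plane with smooth entries. -/
def smoothMatrix (N : ℕ) : Subring (ℝ × ℝ → Matrix (Fin N) (Fin N) ℂ) where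
  carrier := {f | ∀ k l, ContDiff ℝ (⊤ : ℕ∞) fun p => f p k l}
  mul_mem' {f g} hf hg k l := by
    simp only [Pi.mul_apply, Matrix.mul_apply]
    exact ContDiff.sum fun i _ => (hf k i).mul (hg i l)
  one_mem' k l := by simpa using contDiff_const
  add_mem' {f g} hf hg k l := (hf k l).add (hg k l)
  zero_mem' k l := contDiff_const
  neg_mem' {f} hf k l := (hf k l).neg

lemma mpdX_apply {f : ℝ × ℝ → Matrix (Fin N) (Fin N) ℂ} (hf : f ∈ smoothMatrix N)
    (p : ℝ × ℝ) (k l : Fin N) : mpdX f p k l = fderiv ℝ (fun q => f q k l) p (1, 0) :=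
  (hf k l).hasDerivAt_slice_fst p |>.deriv

lemma mpdT_apply {f : ℝ × ℝ → Matrix (Fin N) (Fin N) ℂ} (hf : f ∈ smoothMatrix N)
    (p : ℝ × ℝ) (k l : Fin N) : mpdT f p k l = fderiv ℝ (fun q => f q k l) p (0, 1) :=
  (hf k l).hasDerivAt_slice_snd p |>.deriv

lemma mpdX_mem {f : ℝ × ℝ → Matrix (Fin N) (Fin N) ℂ} (hf : f ∈ smoothMatrix N) :
    mpdX f ∈ smoothMatrix N := fun k l => by
  simpa only [mpdX_apply hf] using contDiff_fderiv_apply_const (hf k l) (1, 0)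

lemma mpdT_mem {f : ℝ × ℝ → Matrix (Fin N) (Fin N) ℂ} (hf : f ∈ smoothMatrix N) :
    mpdT f ∈ smoothMatrix N := fun k l => by
  simpa only [mpdT_apply hf] using contDiff_fderiv_apply_const (hf k l) (0, 1)

lemma mpdX_mpdT_comm_s13 {f : ℝ × ℝ → Matrix (Fin N) (Fin N) ℂ} (hf : f ∈ smoothMatrix N) :
    mpdX (mpdT f) = mpdT (mpdX f) := by
  ext p k l
  simp only [mpdX_apply (mpdT_mem hf), mpdT_apply (mpdX_mem hf), mpdX_apply hf, mpdT_apply hf]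
  exact fderiv_fderiv_apply_comm (hf k l) p (0, 1) (1, 0)

lemma fderiv_entry_add {f g : ℝ × ℝ → Matrix (Fin N) (Fin N) ℂ} (hf : f ∈ smoothMatrix N)
    (hg : g ∈ smoothMatrix N) (p : ℝ × ℝ) (k l : Fin N) :
    fderiv ℝ (fun q => (f + g) q k l) p =
      fderiv ℝ (fun q => f q k l) p + fderiv ℝ (fun q => g q k l) p :=
  fderiv_add ((hf k l).differentiable (by simp) p) ((hg k l).differentiable (by simp) p)

lemma fderiv_entry_mul {f g : ℝ × ℝ → Matrix (Fin N) (Fin N) ℂ} (hf : f ∈ smoothMatrix N)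
    (hg : g ∈ smoothMatrix N) (p v : ℝ × ℝ) (k l : Fin N) :
    fderiv ℝ (fun q => (f * g) q k l) p v =
      ∑ i, fderiv ℝ (fun q => f q k i) p v * g p i l +
        ∑ i, f p k i * fderiv ℝ (fun q => g q i l) p v := by
  have h : ∀ i, HasFDerivAt (fun q => f q k i * g q i l)
      (f p k i • fderiv ℝ (fun q => g q i l) p + g p i l • fderiv ℝ (fun q => f q k i) p) p :=
    fun i => ((hf k i).differentiable (by simp) p).hasFDerivAt.mul
      ((hg i l).differentiable (by simp) p).hasFDerivAt
  have hs := HasFDerivAt.fun_sum (u := Finset.univ) fun i _ => h i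
  simp only [Pi.mul_apply, Matrix.mul_apply]
  rw [hs.fderiv, ← Finset.sum_add_distrib, sum_apply]
  refine Finset.sum_congr rfl fun i _ => ?_
  simp only [add_apply, smul_apply, smul_eq_mul]
  ring

/-- The `x`-derivative on smooth matrix functions. -/
noncomputable def smoothMatrixDX (N : ℕ) : smoothMatrix N →+ smoothMatrix N :=
  AddMonoidHom.mk' (fun f => ⟨mpdX f, mpdX_mem f.2⟩) fun f g => by
    ext p k l
    simpa [mpdX_apply, f.2, g.2, add_mem] using
      DFunLike.congr_fun (fderiv_entry_add f.2 g.2 p k l) (1, 0)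

/-- The `t`-derivative on smooth matrix functions. -/
noncomputable def smoothMatrixDT (N : ℕ) : smoothMatrix N →+ smoothMatrix N :=
  AddMonoidHom.mk' (fun f => ⟨mpdT f, mpdT_mem f.2⟩) fun f g => by
    ext p k l
    simpa [mpdT_apply, f.2, g.2, add_mem] using
      DFunLike.congr_fun (fderiv_entry_add f.2 g.2 p k l) (0, 1)

lemma coe_smoothMatrixDX (f : smoothMatrix N) :
    (smoothMatrixDX N f : ℝ × ℝ → Matrix (Fin N) (Fin N) ℂ) = mpdX f := rfl

lemma coe_smoothMatrixDT (f : smoothMatrix N) :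
    (smoothMatrixDT N f : ℝ × ℝ → Matrix (Fin N) (Fin N) ℂ) = mpdT f := rfl

lemma coe_iterate_smoothMatrixDX (i : ℕ) (f : smoothMatrix N) :
    ((smoothMatrixDX N)^[i] f : ℝ × ℝ → Matrix (Fin N) (Fin N) ℂ) = mpdX^[i] f :=
  Function.Semiconj.iterate_right (f := Subtype.val) coe_smoothMatrixDX i f

lemma smoothMatrixDX_mul (f g : smoothMatrix N) :
    smoothMatrixDX N (f * g) = smoothMatrixDX N f * g + f * smoothMatrixDX N g := by
  ext p k l
  have h := fderiv_entry_mul f.2 g.2 p (1, 0) k l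
  simpa only [coe_smoothMatrixDX, Subring.coe_mul, Subring.coe_add, Pi.add_apply, Pi.mul_apply,
    Matrix.add_apply, Matrix.mul_apply, mpdX_apply f.2, mpdX_apply g.2,
    mpdX_apply (mul_mem f.2 g.2)] using h

lemma smoothMatrixDT_mul (f g : smoothMatrix N) :
    smoothMatrixDT N (f * g) = smoothMatrixDT N f * g + f * smoothMatrixDT N g := by
  ext p k l
  have h := fderiv_entry_mul f.2 g.2 p (0, 1) k l
  simpa only [coe_smoothMatrixDT, Subring.coe_mul, Subring.coe_add, Pi.add_apply, Pi.mul_apply,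
    Matrix.add_apply, Matrix.mul_apply, mpdT_apply f.2, mpdT_apply g.2,
    mpdT_apply (mul_mem f.2 g.2)] using h

lemma contDiff_det {f : ℝ × ℝ → Matrix (Fin N) (Fin N) ℂ} (hf : f ∈ smoothMatrix N) :
    ContDiff ℝ (⊤ : ℕ∞) fun p => (f p).det := by
  simp only [Matrix.det_apply]
  exact ContDiff.sum fun σ _ => (contDiff_prod fun i _ => hf (σ i) i).const_smul _

lemma inv_mem_smoothMatrix {f : ℝ × ℝ → Matrix (Fin N) (Fin N) ℂ} (hf : f ∈ smoothMatrix N)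
    (hu : ∀ p, IsUnit (f p)) : (fun p => (f p)⁻¹) ∈ smoothMatrix N := by
  intro k l
  simp only [Matrix.inv_def, Matrix.smul_apply, Ring.inverse_eq_inv', smul_eq_mul,
    Matrix.adjugate_apply]
  refine ((contDiff_det hf).inv fun p => ?_).mul (contDiff_det fun i j => ?_)
  · exact ((Matrix.isUnit_iff_isUnit_det _).mp (hu p)).ne_zero
  · simp only [Matrix.updateRow_apply]
    split_ifs
    · exact contDiff_const
    · exact hf i j

end SmoothMatrix

section Columns

variable {N : ℕ}

/-- The matrix function all of whose columns are the given vector function. -/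
def repeatCol (ψ : ℝ × ℝ → (Fin N → ℂ)) : ℝ × ℝ → Matrix (Fin N) (Fin N) ℂ :=
  fun p => Matrix.of fun k _ => ψ p k

lemma repeatCol_apply (ψ : ℝ × ℝ → (Fin N → ℂ)) (p : ℝ × ℝ) (k l : Fin N) :
    repeatCol ψ p k l = ψ p k := rfl

lemma repeatCol_mem {ψ : ℝ × ℝ → (Fin N → ℂ)} (hψ : ContDiff ℝ (⊤ : ℕ∞) ψ) :
    repeatCol ψ ∈ smoothMatrix N := fun k _ => contDiff_pi.mp hψ k

lemma contDiff_of_repeatCol_mem {ψ : ℝ × ℝ → (Fin N → ℂ)} (h : repeatCol ψ ∈ smoothMatrix N) :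
    ContDiff ℝ (⊤ : ℕ∞) ψ := contDiff_pi.mpr fun k => h k k

lemma repeatCol_mulVec (f : ℝ × ℝ → Matrix (Fin N) (Fin N) ℂ) (ψ : ℝ × ℝ → (Fin N → ℂ)) :
    repeatCol (fun p => (f p).mulVec (ψ p)) = f * repeatCol ψ := by
  ext p k l
  simp [repeatCol, Matrix.mulVec, dotProduct, Matrix.mul_apply]

lemma repeatCol_vpdX {ψ : ℝ × ℝ → (Fin N → ℂ)} (hψ : ContDiff ℝ (⊤ : ℕ∞) ψ) :
    repeatCol (vpdX ψ) = mpdX (repeatCol ψ) := by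
  ext p k l
  have h := hasDerivAt_pi.mpr fun k => (contDiff_pi.mp hψ k).hasDerivAt_slice_fst p
  rw [mpdX_apply (repeatCol_mem hψ)]
  exact congrFun h.deriv k

lemma repeatCol_vpdT {ψ : ℝ × ℝ → (Fin N → ℂ)} (hψ : ContDiff ℝ (⊤ : ℕ∞) ψ) :
    repeatCol (vpdT ψ) = mpdT (repeatCol ψ) := by
  ext p k l
  have h := hasDerivAt_pi.mpr fun k => (contDiff_pi.mp hψ k).hasDerivAt_slice_snd p
  rw [mpdT_apply (repeatCol_mem hψ)]
  exact congrFun h.deriv k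

lemma contDiff_vpdX_s13 {ψ : ℝ × ℝ → (Fin N → ℂ)} (hψ : ContDiff ℝ (⊤ : ℕ∞) ψ) :
    ContDiff ℝ (⊤ : ℕ∞) (vpdX ψ) :=
  contDiff_of_repeatCol_mem (by rw [repeatCol_vpdX hψ]; exact mpdX_mem (repeatCol_mem hψ))

lemma contDiff_mulVec {f : ℝ × ℝ → Matrix (Fin N) (Fin N) ℂ} (hf : f ∈ smoothMatrix N)
    {ψ : ℝ × ℝ → (Fin N → ℂ)} (hψ : ContDiff ℝ (⊤ : ℕ∞) ψ) :
    ContDiff ℝ (⊤ : ℕ∞) fun p => (f p).mulVec (ψ p) :=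
  contDiff_of_repeatCol_mem (by rw [repeatCol_mulVec]; exact mul_mem hf (repeatCol_mem hψ))

lemma contDiff_iterate_vpdX_s13 {ψ : ℝ × ℝ → (Fin N → ℂ)} (hψ : ContDiff ℝ (⊤ : ℕ∞) ψ) (i : ℕ) :
    ContDiff ℝ (⊤ : ℕ∞) (vpdX^[i] ψ) := by
  induction i with
  | zero => exact hψ
  | succ i ih => rw [Function.iterate_succ_apply']; exact contDiff_vpdX_s13 ih

lemma repeatCol_iterate_vpdX {ψ : ℝ × ℝ → (Fin N → ℂ)} (hψ : ContDiff ℝ (⊤ : ℕ∞) ψ) (i : ℕ) :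
    repeatCol (vpdX^[i] ψ) = mpdX^[i] (repeatCol ψ) := by
  induction i with
  | zero => rfl
  | succ i ih =>
    rw [Function.iterate_succ_apply', Function.iterate_succ_apply',
      repeatCol_vpdX (contDiff_iterate_vpdX_s13 hψ i), ih]

/-- Applying `∂_t + ∑ u i ∂_x ^ i` commutes with repeating columns. -/
lemma repeatCol_operator (n : ℕ) (u : ℕ → ℝ × ℝ → Matrix (Fin N) (Fin N) ℂ)
    {ψ : ℝ × ℝ → (Fin N → ℂ)} (hψ : ContDiff ℝ (⊤ : ℕ∞) ψ) :
    repeatCol (fun p => vpdT ψ p + ∑ i ∈ Finset.Icc 1 n, (u i p).mulVec ((vpdX^[i] ψ) p)) =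
      mpdT (repeatCol ψ) + ∑ i ∈ Finset.Icc 1 n, u i * mpdX^[i] (repeatCol ψ) := by
  rw [← repeatCol_vpdT hψ]
  simp only [← repeatCol_iterate_vpdX hψ, ← repeatCol_mulVec]
  ext p k l
  simp [repeatCol_apply, Finset.sum_apply, Matrix.sum_apply]

end Columns

/-- Composed Darboux transformation `G_θ = (θ⁻¹)_x⁻¹ ∂_x θ⁻¹` for matrix
operators `L = ∂_t + Σ_{i=1}^n u_i ∂_x^i` without multiplicative term.  Given
a matrix solution `θ` of `L(θ) = 0` with `θ` and `∂_x(θ⁻¹)` everywhere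
invertible, there is an operator `L̃` of the same form with
`L̃(G_θψ) = G_θ(L(ψ))` for every smooth `ψ`. -/
theorem composed_darboux (N n : ℕ) (hN : 1 ≤ N) (hn : 1 ≤ n)
    (u : ℕ → ℝ × ℝ → Matrix (Fin N) (Fin N) ℂ)
    (hu : ∀ i ∈ Finset.Icc 1 n, ∀ k l : Fin N, ContDiff ℝ (⊤ : ℕ∞) fun p => u i p k l)
    (θ : ℝ × ℝ → Matrix (Fin N) (Fin N) ℂ)
    (hθs : ∀ k l : Fin N, ContDiff ℝ (⊤ : ℕ∞) fun p => θ p k l)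
    (hθinv : ∀ p : ℝ × ℝ, IsUnit (θ p))
    (hθxinv : ∀ p : ℝ × ℝ, IsUnit (mpdX (fun q => (θ q)⁻¹) p))
    (hθL : ∀ p : ℝ × ℝ,
      mpdT θ p + ∑ i ∈ Finset.Icc 1 n, u i p * (mpdX^[i] θ) p = 0) :
    ∃ ut : ℕ → ℝ × ℝ → Matrix (Fin N) (Fin N) ℂ,
      (∀ i ∈ Finset.Icc 1 n, ∀ k l : Fin N, ContDiff ℝ (⊤ : ℕ∞) fun p => ut i p k l) ∧
      ∀ ψ : ℝ × ℝ → (Fin N → ℂ), ContDiff ℝ (⊤ : ℕ∞) ψ →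
        ∀ p : ℝ × ℝ,
          vpdT (fun q =>
              ((mpdX (fun r => (θ r)⁻¹) q)⁻¹).mulVec
                (vpdX (fun r => ((θ r)⁻¹).mulVec (ψ r)) q)) p +
            ∑ i ∈ Finset.Icc 1 n,
              (ut i p).mulVec
                ((vpdX^[i] fun q =>
                    ((mpdX (fun r => (θ r)⁻¹) q)⁻¹).mulVec
                      (vpdX (fun r => ((θ r)⁻¹).mulVec (ψ r)) q)) p) =
          ((mpdX (fun r => (θ r)⁻¹) p)⁻¹).mulVec
            (vpdX (fun q =>
                ((θ q)⁻¹).mulVec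
                  (vpdT ψ q +
                    ∑ i ∈ Finset.Icc 1 n, (u i q).mulVec ((vpdX^[i] ψ) q))) p) := by
  set ρ : ℝ × ℝ → Matrix (Fin N) (Fin N) ℂ := fun r => (θ r)⁻¹ with hρdef
  set B : ℝ × ℝ → Matrix (Fin N) (Fin N) ℂ := fun r => (mpdX ρ r)⁻¹ with hBdef
  have hρ : ρ ∈ smoothMatrix N := inv_mem_smoothMatrix hθs hθinv
  have hB : B ∈ smoothMatrix N := inv_mem_smoothMatrix (mpdX_mem hρ) hθxinv
  have hdet : ∀ {M : Matrix (Fin N) (Fin N) ℂ}, IsUnit M → IsUnit M.det :=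
    fun h => (Matrix.isUnit_iff_isUnit_det _).mp h
  let U : ℕ → smoothMatrix N := fun i =>
    if h : i ∈ Finset.Icc 1 n then ⟨u i, hu i h⟩ else 0
  have hU : ∀ i ∈ Finset.Icc 1 n, (U i : ℝ × ℝ → Matrix (Fin N) (Fin N) ℂ) = u i :=
    fun i hi => by simp only [U, dif_pos hi]
  have hUsum : ∀ X : ℕ → ℝ × ℝ → Matrix (Fin N) (Fin N) ℂ,
      ∑ i ∈ Finset.Icc 1 n, (U i : ℝ × ℝ → Matrix (Fin N) (Fin N) ℂ) * X i =
        ∑ i ∈ Finset.Icc 1 n, u i * X i :=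
    fun X => Finset.sum_congr rfl fun i hi => by rw [hU i hi]
  obtain ⟨ut, hut⟩ := exists_darboux (smoothMatrixDX N) (smoothMatrixDT N) smoothMatrixDX_mul
    smoothMatrixDT_mul (fun f => Subtype.ext (mpdX_mpdT_comm_s13 f.2)) n U
    (θ := ⟨θ, hθs⟩) (ρ := ⟨ρ, hρ⟩) (B := ⟨B, hB⟩)
    (Subtype.ext (funext fun p => Matrix.mul_nonsing_inv _ (hdet (hθinv p))))
    (Subtype.ext (funext fun p => Matrix.nonsing_inv_mul _ (hdet (hθinv p))))
    (Subtype.ext (funext fun p => Matrix.mul_nonsing_inv _ (hdet (hθxinv p))))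
    (Subtype.ext (funext fun p => Matrix.nonsing_inv_mul _ (hdet (hθxinv p))))
    (Subtype.ext (by
      simp only [Subring.coe_add, AddSubmonoidClass.coe_finsetSum, Subring.coe_mul,
        coe_smoothMatrixDT, coe_iterate_smoothMatrixDX, hUsum]
      funext p
      simpa [Finset.sum_apply] using hθL p))
  refine ⟨fun i => ut i, fun i _ => (ut i).2, fun ψ hψ p => ?_⟩
  have hφ := contDiff_mulVec hρ hψ
  have hη := contDiff_mulVec hB (contDiff_vpdX_s13 hφ)
  have hLψ : ContDiff ℝ (⊤ : ℕ∞) fun p =>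
      vpdT ψ p + ∑ i ∈ Finset.Icc 1 n, (u i p).mulVec ((vpdX^[i] ψ) p) := by
    refine contDiff_of_repeatCol_mem ?_
    rw [repeatCol_operator n u hψ]
    refine add_mem (mpdT_mem (repeatCol_mem hψ)) (sum_mem fun i hi => mul_mem (hu i hi) ?_)
    rw [← repeatCol_iterate_vpdX hψ]
    exact repeatCol_mem (contDiff_iterate_vpdX_s13 hψ i)
  have hmain := congrArg Subtype.val (hut ⟨repeatCol ψ, repeatCol_mem hψ⟩)
  simp only [Subring.coe_add, AddSubmonoidClass.coe_finsetSum, Subring.coe_mul,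
    coe_smoothMatrixDT, coe_smoothMatrixDX, coe_iterate_smoothMatrixDX, hUsum] at hmain
  rw [← repeatCol_operator n u hψ, ← repeatCol_mulVec, ← repeatCol_mulVec, ← repeatCol_vpdX hφ,
    ← repeatCol_vpdX (contDiff_mulVec hρ hLψ), ← repeatCol_mulVec, ← repeatCol_mulVec,
    ← repeatCol_operator n (fun i => ut i) hη] at hmain
  funext k
  exact congrFun (congrFun (congrFun hmain p) k) k
end
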